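/- arXiv:2406.14341 — 5 statements merged into one kernel-verified Lean document; each statement's English description precedes it below -/
import Mathlib

section
/- Let A and B be finite sets, E ⊆ A × B a bipartite edge set, and w : A → ℝ a weight function. Let b₀ ∉ B be a new ground-truth vertex and let E' = E ∪ (A₀ × {b₀}) for some set A₀ ⊆ A of predictions joined to b₀ (each new edge (a, b₀) carrying weight w a). Then every optimal matching m' of E' satisfies: either the cardinality of m' is strictly greater than the maximum matching cardinality of E, or the cost of m' equals the cost of the optimal matchings of E. -/
/-- A matching of a bipartite edge set `E ⊆ A × B`: a subset of `E` in which no two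
distinct edges share a first coordinate and no two distinct edges share a second
coordinate. -/
def IsMatching {α β : Type*} (E m : Finset (α × β)) : Prop :=
  m ⊆ E ∧ (∀ e ∈ m, ∀ e' ∈ m, e.1 = e'.1 → e = e') ∧
    (∀ e ∈ m, ∀ e' ∈ m, e.2 = e'.2 → e = e')

/-- The cost of a matching: the sum over its edges of the weight of the prediction
endpoint. -/
noncomputable def matchCost {α β : Type*} (w : α → ℝ) (m : Finset (α × β)) : ℝ :=
  ∑ e ∈ m, w e.1

/-- An optimal matching of `E` w.r.t. weights `w`: it has maximum cardinality among all
matchings of `E` and, among matchings of that maximum cardinality, minimum cost. -/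
def IsOptimal {α β : Type*} (E : Finset (α × β)) (w : α → ℝ) (m : Finset (α × β)) : Prop :=
  IsMatching E m ∧ (∀ m', IsMatching E m' → m'.card ≤ m.card) ∧
    (∀ m', IsMatching E m' → m'.card = m.card → matchCost w m ≤ matchCost w m')

def IsM {α β : Type*} (m : Finset (α × β)) : Prop :=
  (∀ e ∈ m, ∀ e' ∈ m, e.1 = e'.1 → e = e') ∧
    (∀ e ∈ m, ∀ e' ∈ m, e.2 = e'.2 → e = e')

lemma IsM.swap {α β : Type*} [DecidableEq α] [DecidableEq β] {m : Finset (α × β)}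
    (hm : IsM m) {a : α} {b c : β} (hab : (a, b) ∈ m) (hc : ∀ e ∈ m, e.2 ≠ c) :
    IsM (insert (a, c) (m.erase (a, b))) ∧
    (insert (a, c) (m.erase (a, b))).card = m.card ∧
    (∀ e ∈ insert (a, c) (m.erase (a, b)), e.2 ≠ b) ∧
    (insert (a, c) (m.erase (a, b))).image Prod.fst = m.image Prod.fst := by
  obtain ⟨h1, h2⟩ := hm
  have hbc : b ≠ c := hc _ hab
  refine ⟨⟨?_, ?_⟩, ?_, ?_, ?_⟩
  · intro e he e' he' h
    simp only [Finset.mem_insert, Finset.mem_erase] at he he'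
    grind
  · intro e he e' he' h
    simp only [Finset.mem_insert, Finset.mem_erase] at he he'
    grind
  · rw [Finset.card_insert_of_notMem, Finset.card_erase_add_one hab]
    intro h
    exact hc _ (Finset.mem_of_mem_erase h) rfl
  · intro e he
    simp only [Finset.mem_insert, Finset.mem_erase] at he
    grind
  · rw [Finset.image_insert]
    ext x
    simp only [Finset.mem_insert, Finset.mem_image, Finset.mem_erase]
    constructor
    · rintro (rfl | ⟨e, ⟨_, he⟩, rfl⟩)
      · exact ⟨_, hab, rfl⟩
      · exact ⟨e, he, rfl⟩
    · rintro ⟨e, he, rfl⟩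
      by_cases h : e = (a, b)
      · left; rw [h]
      · right; exact ⟨e, ⟨h, he⟩, rfl⟩

lemma exchange {α β : Type*} [DecidableEq α] [DecidableEq β] (n : Finset (α × β))
    (hn : IsM n) : ∀ (k : ℕ) (m : Finset (α × β)) (b : β), (n \ m).card ≤ k → IsM m →
    (∀ e ∈ m, e.2 ≠ b) →
    (∃ M, IsM M ∧ M ⊆ m ∪ n ∧ M.card = m.card + 1) ∨
    (∃ N, IsM N ∧ N ⊆ m ∪ n ∧ (∀ e ∈ N, e.2 ≠ b) ∧
      N.image Prod.fst = n.image Prod.fst) := by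
  intro k
  induction k with
  | zero =>
    intro m b hk hm hb
    right
    have : n ⊆ m := by
      rw [← Finset.sdiff_eq_empty_iff_subset]
      exact Finset.card_eq_zero.mp (by omega)
    exact ⟨n, hn, Finset.subset_union_right, fun e he => hb e (this he), rfl⟩
  | succ k ih =>
    intro m b hk hm hb
    by_cases hnb : ∀ e ∈ n, e.2 ≠ b
    · exact Or.inr ⟨n, hn, Finset.subset_union_right, hnb, rfl⟩
    push Not at hnb
    obtain ⟨⟨a, b'⟩, hab, rfl⟩ := hnb
    simp only at hb ⊢
    have habm : (a, b') ∉ m := fun h => hb _ h rfl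
    by_cases ham : ∃ c, (a, c) ∈ m
    · obtain ⟨c, hc⟩ := ham
      have hcb : c ≠ b' := hb _ hc
      obtain ⟨s1, s2, s3, s4⟩ := hm.swap hc hb
      have hacn : (a, c) ∉ n := fun h => hcb (by simpa using hn.1 _ h _ hab rfl)
      have hsub : insert (a, b') (m.erase (a, c)) ∪ n ⊆ m ∪ n := by
        intro e he
        simp only [Finset.mem_union, Finset.mem_insert, Finset.mem_erase] at he ⊢
        grind
      have hlt : (n \ insert (a, b') (m.erase (a, c))).card < (n \ m).card := by
        apply Finset.card_lt_card
        rw [Finset.ssubset_iff_of_subset]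
        · exact ⟨(a, b'), by simp [hab, habm], by simp⟩
        · intro e he
          simp only [Finset.mem_sdiff, Finset.mem_insert, Finset.mem_erase] at he ⊢
          grind
      rcases ih _ c (by omega) s1 s3 with ⟨M, hM, hMs, hMc⟩ | ⟨N, hN, hNs, hNc, hNi⟩
      · exact Or.inl ⟨M, hM, hMs.trans hsub, by omega⟩
      · right
        have haN : (a, b') ∈ N := by
          have : a ∈ N.image Prod.fst := by
            rw [hNi]; exact Finset.mem_image_of_mem Prod.fst hab
          obtain ⟨⟨x, y⟩, he, hx⟩ := Finset.mem_image.mp this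
          simp only at hx
          subst hx
          rcases Finset.mem_union.mp (hNs he) with h | h
          · rwa [← s1.1 _ h (x, b') (by simp) rfl]
          · rwa [← hn.1 _ h (x, b') hab rfl]
        obtain ⟨t1, t2, t3, t4⟩ := hN.swap haN hNc
        refine ⟨_, t1, ?_, t3, t4.trans hNi⟩
        intro e he
        rcases Finset.mem_insert.mp he with rfl | h
        · exact Finset.mem_union_left _ hc
        · exact hsub (hNs (Finset.mem_of_mem_erase h))
    · left
      push Not at ham
      refine ⟨insert (a, b') m, ⟨?_, ?_⟩, ?_, Finset.card_insert_of_notMem habm⟩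
      · have := hm.1
        intro e he e' he' h
        simp only [Finset.mem_insert] at he he'
        grind
      · have := hm.2
        intro e he e' he' h
        simp only [Finset.mem_insert] at he he'
        grind
      · intro e he
        simp only [Finset.mem_union, Finset.mem_insert] at he ⊢
        grind

lemma IsM.card_image {α β : Type*} [DecidableEq α] {m : Finset (α × β)}
    (hm : IsM m) : (m.image Prod.fst).card = m.card :=
  Finset.card_image_of_injOn fun e he e' he' h => hm.1 e he e' he' h

lemma IsM.cost {α β : Type*} [DecidableEq α] {m : Finset (α × β)}
    (hm : IsM m) (w : α → ℝ) : matchCost w m = ∑ a ∈ m.image Prod.fst, w a := by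
  rw [Finset.sum_image fun e he e' he' h => hm.1 e he e' he' h]
  rfl

/-- **Lemma A.** Adding one new ground-truth vertex `b₀ ∉ B`, joined to a set of
predictions `A₀ ⊆ A` (each new edge `(a, b₀)` carrying weight `w a`): every optimal
matching `m'` of the extended edge set `E'` either has cardinality strictly greater than
the maximum matching cardinality of `E` (which is the cardinality of an optimal matching
`m` of `E`), or its cost equals the cost of the optimal matchings of `E`. -/
theorem optimal_extend_groundTruth {α β : Type*} [DecidableEq α] [DecidableEq β]
    (A : Finset α) (B : Finset β) (E : Finset (α × β)) (hE : E ⊆ A ×ˢ B)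
    (w : α → ℝ) (b₀ : β) (hb₀ : b₀ ∉ B) (A₀ : Finset α) (hA₀ : A₀ ⊆ A)
    (E' : Finset (α × β)) (hE' : E' = E ∪ A₀ ×ˢ {b₀})
    (m m' : Finset (α × β)) (hm : IsOptimal E w m) (hm' : IsOptimal E' w m') :
    m.card < m'.card ∨ matchCost w m' = matchCost w m := by
  obtain ⟨⟨ms, mM⟩, mmax, mmin⟩ := hm
  obtain ⟨⟨ms', mM'⟩, mmax', mmin'⟩ := hm'
  have hEE : E ⊆ E' := by rw [hE']; exact Finset.subset_union_left
  have hle := mmax' m ⟨ms.trans hEE, mM⟩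
  rcases hle.lt_or_eq with hlt | heq
  · exact Or.inl hlt
  right
  have hb : ∀ e ∈ m, e.2 ≠ b₀ := by
    intro e he h
    exact hb₀ (h ▸ (Finset.mem_product.mp (hE (ms he))).2)
  have hsub : m ∪ m' ⊆ E' := Finset.union_subset (ms.trans hEE) ms'
  rcases exchange m' mM' _ m b₀ le_rfl mM hb with ⟨M, hM, hMs, hMc⟩ | ⟨N, hN, hNs, hNb, hNi⟩
  · have := mmax' M ⟨hMs.trans hsub, hM⟩
    omega
  · apply le_antisymm (mmin' m ⟨ms.trans hEE, mM⟩ heq)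
    have hc : N.card = m'.card := by
      rw [← hN.card_image, hNi]; exact IsM.card_image mM'
    have hcost : matchCost w N = matchCost w m' := by
      rw [hN.cost, hNi]; exact (IsM.cost mM' w).symm
    rw [← hcost]
    refine mmin N ⟨?_, hN⟩ (by omega)
    intro e he
    have h := hsub (hNs he)
    rw [hE', Finset.mem_union, Finset.mem_product, Finset.mem_singleton] at h
    rcases h with h | h
    · exact h
    · exact absurd h.2 (hNb e he)
end

section
/- Let A and B be finite sets, E ⊆ A × B a bipartite edge set, and w : A → ℝ a weight function. Let b₀ ∉ B and E' = E ∪ (A₀ × {b₀}) for some A₀ ⊆ A, each new edge (a, b₀) carrying weight w a. Suppose m is an optimal matching of E, m' is an optimal matching of E' containing an edge incident to b₀, and m' has the same cardinality as m. Then there exists a matching m̂ of E' that contains no edge incident to b₀, has the same cardinality as m', and has cost equal to the cost of m'. -/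
theorem im_erase {α β : Type*} [DecidableEq α] [DecidableEq β] {m : Finset (α × β)}
    (h : IsMatching m m) (e : α × β) : IsMatching (m.erase e) (m.erase e) := by
  refine ⟨subset_rfl, fun x hx y hy => h.2.1 x (Finset.mem_of_mem_erase hx) y (Finset.mem_of_mem_erase hy),
    fun x hx y hy => h.2.2 x (Finset.mem_of_mem_erase hx) y (Finset.mem_of_mem_erase hy)⟩

theorem im_insert {α β : Type*} [DecidableEq α] [DecidableEq β] {E F m : Finset (α × β)}
    (h : IsMatching E m) (hEF : E ⊆ F) (e : α × β) (he : e ∈ F)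
    (h1 : ∀ x ∈ m, x.1 ≠ e.1) (h2 : ∀ x ∈ m, x.2 ≠ e.2) : IsMatching F (insert e m) := by
  refine ⟨Finset.insert_subset he (h.1.trans hEF), ?_, ?_⟩
  · intro x hx y hy hxy
    rcases Finset.mem_insert.1 hx with rfl | hx1 <;> rcases Finset.mem_insert.1 hy with rfl | hy
    · rfl
    · exact absurd hxy.symm (h1 y hy)
    · exact absurd hxy (h1 x hx1)
    · exact h.2.1 x hx1 y hy hxy
  · intro x hx y hy hxy
    rcases Finset.mem_insert.1 hx with rfl | hx1 <;> rcases Finset.mem_insert.1 hy with rfl | hy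
    · rfl
    · exact absurd hxy.symm (h2 y hy)
    · exact absurd hxy (h2 x hx1)
    · exact h.2.2 x hx1 y hy hxy

theorem swap_aux {α β : Type*} [DecidableEq α] [DecidableEq β] (w : α → ℝ) (k : ℕ) :
    ∀ (n m : Finset (α × β)) (b : β), n.card = k → IsMatching n n → IsMatching m m →
      (∃ e ∈ n, e.2 = b) → (∀ e ∈ m, e.2 ≠ b) →
      (∃ p, IsMatching (n ∪ m) p ∧ (∀ e ∈ p, e.2 ≠ b) ∧ p.card = n.card ∧
        matchCost w p = matchCost w n) ∨
      (∃ p, IsMatching (n ∪ m) p ∧ p.card = m.card + 1) := by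
  induction k with
  | zero =>
    rintro n m b hk hn hm ⟨e, he, -⟩ -
    rw [Finset.card_eq_zero] at hk
    simp [hk] at he
  | succ k ih =>
    rintro n m b hk hn hm ⟨⟨a, b'⟩, he, rfl⟩ hmb
    simp only at hmb ⊢
    by_cases ha : ∃ f ∈ m, f.1 = a
    swap
    · right
      push Not at ha
      refine ⟨insert (a, b') m, im_insert hm Finset.subset_union_right _
        (Finset.mem_union_left _ he) ha hmb, ?_⟩
      rw [Finset.card_insert_of_notMem]
      exact fun h => ha _ h rfl
    obtain ⟨⟨a', c⟩, hf, rfl⟩ := ha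
    simp only at he
    have hcb : c ≠ b' := hmb _ hf
    have hn1 := im_erase hn (a', b')
    have hm1 := im_erase hm (a', c)
    have na : ∀ x ∈ n.erase (a', b'), x.1 ≠ a' := fun x hx h =>
      (Finset.mem_erase.1 hx).1 (hn.2.1 x (Finset.mem_of_mem_erase hx) _ he h)
    have nb : ∀ x ∈ n.erase (a', b'), x.2 ≠ b' := fun x hx h =>
      (Finset.mem_erase.1 hx).1 (hn.2.2 x (Finset.mem_of_mem_erase hx) _ he h)
    have ma : ∀ x ∈ m.erase (a', c), x.1 ≠ a' := fun x hx h =>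
      (Finset.mem_erase.1 hx).1 (hm.2.1 x (Finset.mem_of_mem_erase hx) _ hf h)
    have mc : ∀ x ∈ m.erase (a', c), x.2 ≠ c := fun x hx h =>
      (Finset.mem_erase.1 hx).1 (hm.2.2 x (Finset.mem_of_mem_erase hx) _ hf h)
    have cn := Finset.card_erase_add_one he
    have cm := Finset.card_erase_add_one hf
    have costn : w a' + matchCost w (n.erase (a', b')) = matchCost w n :=
      Finset.add_sum_erase n (fun e => w e.1) he
    have hsub : n.erase (a', b') ∪ m.erase (a', c) ⊆ n ∪ m :=
      Finset.union_subset_union (Finset.erase_subset _ _) (Finset.erase_subset _ _)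
    -- finishing step for the first alternative
    have fin1 : ∀ p, IsMatching (n.erase (a', b') ∪ m.erase (a', c)) p → (∀ e ∈ p, e.2 ≠ c) →
        p.card = (n.erase (a', b')).card → matchCost w p = matchCost w (n.erase (a', b')) →
        ∃ p, IsMatching (n ∪ m) p ∧ (∀ e ∈ p, e.2 ≠ b') ∧ p.card = n.card ∧
          matchCost w p = matchCost w n := by
      intro p hp hpc hpk hpw
      have pa : ∀ x ∈ p, x.1 ≠ a' := fun x hx =>
        (Finset.mem_union.1 (hp.1 hx)).elim (na x) (ma x)
      have hnot : (a', c) ∉ p := fun h => pa _ h rfl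
      refine ⟨insert (a', c) p, im_insert hp hsub _ (Finset.mem_union_right _ hf) pa hpc, ?_, ?_, ?_⟩
      · intro x hx
        rcases Finset.mem_insert.1 hx with rfl | hx
        · exact hcb
        · exact (Finset.mem_union.1 (hp.1 hx)).elim (nb x)
            (fun h => hmb x (Finset.mem_of_mem_erase h))
      · rw [Finset.card_insert_of_notMem hnot]; omega
      · rw [← costn, ← hpw]
        exact Finset.sum_insert hnot
    by_cases hc : ∃ e ∈ n.erase (a', b'), e.2 = c
    swap
    · left
      push Not at hc
      exact fin1 _ ⟨Finset.subset_union_left, hn1.2⟩ hc rfl rfl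
    rcases ih (n.erase (a', b')) (m.erase (a', c)) c (by omega) hn1 hm1 hc mc with
      ⟨p, hp, hpc, hpk, hpw⟩ | ⟨p, hp, hpk⟩
    · exact Or.inl (fin1 p hp hpc hpk hpw)
    · right
      have pa : ∀ x ∈ p, x.1 ≠ a' := fun x hx =>
        (Finset.mem_union.1 (hp.1 hx)).elim (na x) (ma x)
      refine ⟨insert (a', b') p, im_insert hp hsub _ (Finset.mem_union_left _ he) pa ?_, ?_⟩
      · exact fun x hx => (Finset.mem_union.1 (hp.1 hx)).elim (nb x)
            (fun h => hmb x (Finset.mem_of_mem_erase h))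
      · rw [Finset.card_insert_of_notMem (fun h => pa _ h rfl)]; omega

/-- **Alternating-walk swap step of Lemma A.** Let `b₀ ∉ B` be a new ground-truth vertex
and `E' = E ∪ (A₀ × {b₀})` for some `A₀ ⊆ A`. If `m` is an optimal matching of `E`, and
`m'` is an optimal matching of `E'` that contains an edge incident to `b₀` and has the
same cardinality as `m`, then there is a matching `m̂` of `E'` containing no edge
incident to `b₀`, with the same cardinality and the same cost as `m'`. -/
theorem exists_matching_avoiding_new_vertex {α β : Type*} [DecidableEq α] [DecidableEq β]
    (A : Finset α) (B : Finset β) (E : Finset (α × β)) (hE : E ⊆ A ×ˢ B)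
    (w : α → ℝ) (b₀ : β) (hb₀ : b₀ ∉ B) (A₀ : Finset α) (hA₀ : A₀ ⊆ A)
    (E' : Finset (α × β)) (hE' : E' = E ∪ A₀ ×ˢ {b₀})
    (m m' : Finset (α × β)) (hm : IsOptimal E w m) (hm' : IsOptimal E' w m')
    (hb : ∃ e ∈ m', e.2 = b₀) (hcard : m'.card = m.card) :
    ∃ mhat, IsMatching E' mhat ∧ (∀ e ∈ mhat, e.2 ≠ b₀) ∧
      mhat.card = m'.card ∧ matchCost w mhat = matchCost w m' := by
  have hEE : E ⊆ E' := hE' ▸ Finset.subset_union_left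
  have hsub : m' ∪ m ⊆ E' := Finset.union_subset hm'.1.1 (hm.1.1.trans hEE)
  rcases swap_aux w m'.card m' m b₀ rfl ⟨subset_rfl, hm'.1.2⟩ ⟨subset_rfl, hm.1.2⟩ hb
    (fun e he h => hb₀ (h ▸ (Finset.mem_product.1 (hE (hm.1.1 he))).2)) with
    ⟨p, hp, h⟩ | ⟨p, hp, hk⟩
  · exact ⟨p, ⟨hp.1.trans hsub, hp.2⟩, h⟩
  · have := hm'.2.1 p ⟨hp.1.trans hsub, hp.2⟩
    omega
end

section
/- Let A and B be finite sets, E ⊆ A × B a bipartite edge set, and s : A → ℝ a score function. Fix α > 0 and β ∈ ℝ, and define transformed scores s' a = α * (s a) + β. Then a matching m of E is optimal with respect to the weights w a = −(s a) if and only if m is optimal with respect to the weights w' a = −(s' a). In particular, the set of optimal matchings is invariant under positive affine (linear calibration) transformations of the scores. -/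
/-- **Calibration invariance of the matching step.** For scores `s`, a positive affine
(linear calibration) transformation `s' a = α * s a + β` with `α > 0` does not change
which matchings are optimal: `m` is optimal w.r.t. `w a = -(s a)` iff `m` is optimal
w.r.t. `w' a = -(s' a)`. -/
theorem isOptimal_affine_calibration_iff {A' B' : Type*}
    (A : Finset A') (B : Finset B') (E : Finset (A' × B')) (hE : E ⊆ A ×ˢ B)
    (s : A' → ℝ) (α β : ℝ) (hα : 0 < α)
    (m : Finset (A' × B')) :
    IsOptimal E (fun a => -(s a)) m ↔
      IsOptimal E (fun a => -(α * s a + β)) m := by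
  have key : ∀ m' : Finset (A' × B'), matchCost (fun a => -(α * s a + β)) m' =
      α * matchCost (fun a => -(s a)) m' - m'.card * β := by
    intro m'
    simp only [matchCost, Finset.mul_sum, neg_add, Finset.sum_add_distrib, Finset.sum_const,
      nsmul_eq_mul, mul_neg]
    ring
  unfold IsOptimal
  refine and_congr_right fun _ => and_congr_right fun _ => ?_
  refine forall_congr' fun m' => forall_congr' fun _ => forall_congr' fun hc => ?_
  rw [key, key, hc, sub_le_sub_iff_right, mul_le_mul_iff_right₀ hα]
end

section
/- Let A and B be finite sets, E ⊆ A × B a bipartite edge set, s : A → ℝ a score function, and set w a = −(s a). For a threshold h ∈ ℝ let E_h = {(a, b) ∈ E : s a > h}. Then for every optimal matching m of E and every threshold h ∈ ℝ, the restriction m_h = {(a, b) ∈ m : s a > h} is an optimal matching of E_h; in particular, the maximum matching cardinality of E_h equals the number of edges of m whose prediction score exceeds h. -/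
open Classical in
/-- The maximum cardinality of a matching of the edge set `E`. -/
noncomputable def maxMatchCard {α β : Type*} (E : Finset (α × β)) : ℕ :=
  (E.powerset.filter fun m => IsMatching E m).sup Finset.card

/-- Set of matched predictions. -/
def fstSet {α β : Type*} [DecidableEq α] (m : Finset (α × β)) : Finset α := m.image Prod.fst

lemma mem_fstSet {α β : Type*} [DecidableEq α] {m : Finset (α × β)} {a : α} :
    a ∈ fstSet m ↔ ∃ b, (a, b) ∈ m := by
  simp [fstSet]

lemma card_fstSet {α β : Type*} [DecidableEq α] {E m : Finset (α × β)} (hm : IsMatching E m) :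
    (fstSet m).card = m.card :=
  Finset.card_image_of_injOn (fun e he e' he' h => hm.2.1 e he e' he' h)

lemma cost_fstSet {α β : Type*} [DecidableEq α] {E m : Finset (α × β)} (hm : IsMatching E m)
    (w : α → ℝ) : matchCost w m = ∑ a ∈ fstSet m, w a :=
  (Finset.sum_image (fun e he e' he' h => hm.2.1 e he e' he' h)).symm

lemma matching_mono {α β : Type*} {E E' m m' : Finset (α × β)} (hm : IsMatching E m)
    (h1 : m' ⊆ m) (h2 : m' ⊆ E') : IsMatching E' m' :=
  ⟨h2, fun e he e' he' => hm.2.1 e (h1 he) e' (h1 he'),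
    fun e he e' he' => hm.2.2 e (h1 he) e' (h1 he')⟩

lemma matching_insert {α β : Type*} [DecidableEq α] [DecidableEq β] {E m : Finset (α × β)}
    (hm : IsMatching E m) {a : α} {b : β} (hE : (a, b) ∈ E)
    (ha : a ∉ fstSet m) (hb : ∀ e ∈ m, e.2 ≠ b) : IsMatching E (insert (a, b) m) := by
  have ha' : ∀ e ∈ m, e.1 ≠ a := fun e he h => ha (mem_fstSet.2 ⟨e.2, by rw [← h]; exact he⟩)
  refine ⟨Finset.insert_subset hE hm.1, ?_, ?_⟩
  · intro e he e' he' h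
    rcases Finset.mem_insert.1 he with rfl | he <;> rcases Finset.mem_insert.1 he' with rfl | he'
    · rfl
    · exact absurd h.symm (ha' _ he')
    · exact absurd h (ha' _ he)
    · exact hm.2.1 _ he _ he' h
  · intro e he e' he' h
    rcases Finset.mem_insert.1 he with rfl | he <;> rcases Finset.mem_insert.1 he' with rfl | he'
    · rfl
    · exact absurd h.symm (hb _ he')
    · exact absurd h (hb _ he)
    · exact hm.2.2 _ he _ he' h

lemma fstSet_insert {α β : Type*} [DecidableEq α] [DecidableEq β] (m : Finset (α × β))
    (a : α) (b : β) : fstSet (insert (a, b) m) = insert a (fstSet m) := by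
  simp [fstSet]

lemma fstSet_erase {α β : Type*} [DecidableEq α] [DecidableEq β] {E m : Finset (α × β)}
    (hm : IsMatching E m) {a : α} {b : β} (h : (a, b) ∈ m) :
    fstSet (m.erase (a, b)) = (fstSet m).erase a := by
  ext x
  simp only [mem_fstSet, Finset.mem_erase]
  constructor
  · rintro ⟨y, hne, hy⟩
    refine ⟨?_, y, hy⟩
    rintro rfl
    exact hne (hm.2.1 _ hy _ h rfl)
  · rintro ⟨hx, y, hy⟩
    exact ⟨y, fun he => hx (congrArg Prod.fst he), hy⟩

lemma augment_aux {α β : Type*} [DecidableEq α] [DecidableEq β] (k : ℕ) :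
    ∀ m n : Finset (α × β), m.card = k → IsMatching m m → IsMatching n n → m.card < n.card →
      ∃ m', IsMatching (m ∪ n) m' ∧ ∃ a ∈ fstSet n, a ∉ fstSet m ∧
        fstSet m' = insert a (fstSet m) := by
  induction k with
  | zero =>
    intro m n hk hm hn hlt
    obtain rfl := Finset.card_eq_zero.1 hk
    obtain ⟨⟨a, b⟩, he⟩ := Finset.card_pos.1 (by omega : 0 < n.card)
    refine ⟨{(a, b)}, ⟨by simpa using he, by simp, by simp⟩, a, mem_fstSet.2 ⟨b, he⟩,
      by simp [fstSet], by simp [fstSet]⟩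
  | succ k ih =>
    intro m n hk hm hn hlt
    have : ∃ a ∈ fstSet n, a ∉ fstSet m :=
      Finset.exists_mem_notMem_of_card_lt_card (by rw [card_fstSet hm, card_fstSet hn]; exact hlt)
    obtain ⟨a, han, ham⟩ := this
    obtain ⟨b, hab⟩ := mem_fstSet.1 han
    by_cases hb : ∀ e ∈ m, e.2 ≠ b
    · exact ⟨insert (a, b) m, matching_insert (matching_mono hm subset_rfl
        Finset.subset_union_left) (Finset.mem_union_right _ hab) ham hb, a, han, ham,
        fstSet_insert _ _ _⟩
    push Not at hb
    obtain ⟨⟨c, b'⟩, hcb, hb'⟩ := hb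
    obtain rfl : b' = b := hb'
    have hcm : c ∈ fstSet m := mem_fstSet.2 ⟨_, hcb⟩
    have hm0 := matching_mono hm (Finset.erase_subset (c, b') m) subset_rfl
    have hn0 := matching_mono hn (Finset.erase_subset (a, b') n) subset_rfl
    have c1 := Finset.card_erase_of_mem hcb
    have c2 := Finset.card_erase_of_mem hab
    obtain ⟨m1, hm1, d, hdn, hdm, hd⟩ := ih _ _ (by omega) hm0 hn0 (by omega)
    rw [fstSet_erase hm hcb] at hdm hd
    rw [fstSet_erase hn hab] at hdn
    have hb1 : ∀ e ∈ m1, e.2 ≠ b' := by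
      intro e he h
      rcases Finset.mem_union.1 (hm1.1 he) with h1 | h1
      · exact (Finset.mem_erase.1 h1).1 (hm.2.2 _ (Finset.mem_erase.1 h1).2 _ hcb h)
      · exact (Finset.mem_erase.1 h1).1 (hn.2.2 _ (Finset.mem_erase.1 h1).2 _ hab h)
    have hm1' : IsMatching (m ∪ n) m1 := matching_mono hm1 subset_rfl
      (hm1.1.trans (Finset.union_subset_union (Finset.erase_subset _ _) (Finset.erase_subset _ _)))
    have hac : a ≠ c := fun h => ham (h ▸ hcm)
    by_cases hdc : d = c
    · subst hdc
      rw [Finset.insert_erase hcm] at hd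
      exact ⟨insert (a, b') m1, matching_insert hm1' (Finset.mem_union_right _ hab)
        (hd ▸ ham) hb1, a, han, ham, by rw [fstSet_insert, hd]⟩
    · refine ⟨insert (c, b') m1, matching_insert hm1' (Finset.mem_union_left _ hcb)
        ?_ hb1, d, Finset.mem_of_mem_erase hdn, ?_, ?_⟩
      · rw [hd]; simp [Ne.symm hdc]
      · intro h; exact hdm (Finset.mem_erase.2 ⟨hdc, h⟩)
      · rw [fstSet_insert, hd, Finset.insert_comm, Finset.insert_erase hcm]

lemma augment {α β : Type*} [DecidableEq α] [DecidableEq β] {E m n : Finset (α × β)}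
    (hm : IsMatching E m) (hn : IsMatching E n) (hlt : m.card < n.card) :
      ∃ m', IsMatching E m' ∧ ∃ a ∈ fstSet n, a ∉ fstSet m ∧
        fstSet m' = insert a (fstSet m) := by
  obtain ⟨m', h1, h2⟩ := augment_aux _ m n rfl (matching_mono hm subset_rfl subset_rfl)
    (matching_mono hn subset_rfl subset_rfl) hlt
  exact ⟨m', matching_mono h1 subset_rfl (h1.1.trans (Finset.union_subset hm.1 hn.1)), h2⟩

lemma extend_aux {α β : Type*} [DecidableEq α] [DecidableEq β] {E m : Finset (α × β)}
    (hm : IsMatching E m) (k : ℕ) : ∀ n, IsMatching E n → n.card + k = m.card →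
      ∃ n', IsMatching E n' ∧ n'.card = m.card ∧ fstSet n ⊆ fstSet n' ∧
        fstSet n' ⊆ fstSet n ∪ fstSet m := by
  induction k with
  | zero => exact fun n hn hk => ⟨n, hn, hk, subset_rfl, Finset.subset_union_left⟩
  | succ k ih =>
    intro n hn hk
    obtain ⟨n1, hn1, a, ha, han, h1⟩ := augment hn hm (by omega)
    have hc : n1.card = n.card + 1 := by
      rw [← card_fstSet hn1, h1, Finset.card_insert_of_notMem han, card_fstSet hn]
    obtain ⟨n2, hn2, h2, h3, h4⟩ := ih n1 hn1 (by omega)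
    rw [h1] at h3 h4
    refine ⟨n2, hn2, h2, (Finset.subset_insert _ _).trans h3, h4.trans ?_⟩
    intro x hx
    simp only [Finset.mem_union, Finset.mem_insert] at hx ⊢
    rcases hx with (rfl | hx) | hx <;> tauto

lemma fstSet_filter {α β : Type*} [DecidableEq α] (m : Finset (α × β)) (s : α → ℝ) (h : ℝ) :
    fstSet (m.filter fun e => s e.1 > h) = (fstSet m).filter fun a => s a > h := by
  ext a; simp [mem_fstSet]

/-- **Corollary of Theorem 4.1 (reuse of a single matching across thresholds).** With
weights `w a = -(s a)` and thresholded edge set `E_h = {(a, b) ∈ E : s a > h}`: for every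
optimal matching `m` of `E` and every threshold `h`, the restriction
`m_h = {(a, b) ∈ m : s a > h}` is an optimal matching of `E_h`; in particular the maximum
matching cardinality of `E_h` equals the number of edges of `m` whose prediction score
exceeds `h`. -/
theorem filter_isOptimal_and_maxMatchCard {α β : Type*} [DecidableEq α] [DecidableEq β]
    (A : Finset α) (B : Finset β) (E : Finset (α × β)) (hE : E ⊆ A ×ˢ B)
    (s : α → ℝ) (w : α → ℝ) (hw : ∀ a, w a = -(s a))
    (m : Finset (α × β)) (hm : IsOptimal E w m) (h : ℝ) :
    IsOptimal (E.filter fun e => s e.1 > h) w (m.filter fun e => s e.1 > h) ∧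
      maxMatchCard (E.filter fun e => s e.1 > h) = (m.filter fun e => s e.1 > h).card := by
  have hmm := hm.1
  have hmh : IsMatching (E.filter fun e => s e.1 > h) (m.filter fun e => s e.1 > h) :=
    matching_mono hmm (Finset.filter_subset _ _) (Finset.filter_subset_filter _ hmm.1)
  have up : ∀ {n}, IsMatching (E.filter fun e => s e.1 > h) n → IsMatching E n :=
    fun hn => matching_mono hn subset_rfl (hn.1.trans (Finset.filter_subset _ _))
  have hgt : ∀ {n}, IsMatching (E.filter fun e => s e.1 > h) n → ∀ a ∈ fstSet n, s a > h := by
    intro n hn a ha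
    obtain ⟨b, hb⟩ := mem_fstSet.1 ha
    exact (Finset.mem_filter.1 (hn.1 hb)).2
  have hcard : ∀ n, IsMatching (E.filter fun e => s e.1 > h) n →
      n.card ≤ (m.filter fun e => s e.1 > h).card := by
    intro n hn
    by_contra! hlt
    obtain ⟨m1, hm1, a, han, ham, h1⟩ := augment hmh hn hlt
    have has := hgt hn a han
    rw [fstSet_filter] at ham h1
    have ham' : a ∉ fstSet m := fun hh => ham (Finset.mem_filter.2 ⟨hh, has⟩)
    have hle := hm.2.1 m1 (up hm1)
    obtain ⟨m2, hm2, hc2, h3, h4⟩ := extend_aux hmm (m.card - m1.card) m1 (up hm1) (by omega)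
    have hsub : fstSet m2 ⊆ insert a (fstSet m) := by
      intro x hx
      have := h4 hx
      rw [h1] at this
      simp only [Finset.mem_union, Finset.mem_insert, Finset.mem_filter] at this ⊢
      tauto
    have ha2 : a ∈ fstSet m2 := h3 (by rw [h1]; exact Finset.mem_insert_self _ _)
    have hcI : (insert a (fstSet m)).card = (fstSet m2).card + 1 := by
      rw [Finset.card_insert_of_notMem ham', card_fstSet hmm, card_fstSet hm2, hc2]
    have hd : (insert a (fstSet m) \ fstSet m2).card = 1 := by
      rw [Finset.card_sdiff_of_subset hsub]; omega
    obtain ⟨c, hc⟩ := Finset.card_eq_one.1 hd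
    have hcm : c ∈ insert a (fstSet m) \ fstSet m2 := by rw [hc]; simp
    rw [Finset.mem_sdiff, Finset.mem_insert] at hcm
    have hcs : s c ≤ h := by
      by_contra! hcs
      apply hcm.2
      apply h3
      rw [h1, Finset.mem_insert, Finset.mem_filter]
      tauto
    have hsum := Finset.sum_sdiff (f := w) hsub
    rw [hc, Finset.sum_singleton, Finset.sum_insert ham', ← cost_fstSet hm2,
      ← cost_fstSet hmm] at hsum
    have := hm.2.2 m2 hm2 hc2
    rw [hw, hw] at hsum
    linarith
  refine ⟨⟨hmh, hcard, ?_⟩, ?_⟩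
  · intro n hn hnc
    have hle := hm.2.1 n (up hn)
    obtain ⟨n2, hn2, hc2, h3, h4⟩ := extend_aux hmm (m.card - n.card) n (up hn) (by omega)
    have hn2h : (n2.filter fun e => s e.1 > h).card ≤ n.card := by
      rw [hnc]
      exact hcard _ (matching_mono hn2 (Finset.filter_subset _ _)
        (Finset.filter_subset_filter _ hn2.1))
    have hn2m : IsMatching E (n2.filter fun e => s e.1 > h) :=
      matching_mono hn2 (Finset.filter_subset _ _) ((Finset.filter_subset _ _).trans hn2.1)
    have e1 : fstSet n = (fstSet n2).filter fun a => s a > h := by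
      apply Finset.eq_of_subset_of_card_le
      · intro x hx
        exact Finset.mem_filter.2 ⟨h3 hx, hgt hn x hx⟩
      · rw [← fstSet_filter, card_fstSet hn2m, card_fstSet hn]
        exact hn2h
    have f1 := Finset.card_filter_add_card_filter_not (s := fstSet n2) (fun a => s a > h)
    have f2 := Finset.card_filter_add_card_filter_not (s := fstSet m) (fun a => s a > h)
    have e2 : ((fstSet n2).filter fun a => ¬ s a > h) = (fstSet m).filter fun a => ¬ s a > h := by
      apply Finset.eq_of_subset_of_card_le
      · intro x hx
        obtain ⟨hx1, hx2⟩ := Finset.mem_filter.1 hx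
        refine Finset.mem_filter.2 ⟨?_, hx2⟩
        rcases Finset.mem_union.1 (h4 hx1) with hh | hh
        · exact absurd (hgt hn x hh) hx2
        · exact hh
      · rw [← e1, card_fstSet hn, card_fstSet hn2] at f1
        rw [← fstSet_filter, card_fstSet hmh, card_fstSet hmm] at f2
        omega
    have g1 := Finset.sum_filter_add_sum_filter_not (fstSet n2) (fun a => s a > h) w
    have g2 := Finset.sum_filter_add_sum_filter_not (fstSet m) (fun a => s a > h) w
    rw [← e1, e2, ← cost_fstSet hn, ← cost_fstSet hn2] at g1
    rw [← fstSet_filter, ← cost_fstSet hmh, ← cost_fstSet hmm] at g2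
    have := hm.2.2 n2 hn2 hc2
    linarith
  · classical
    unfold maxMatchCard
    apply le_antisymm
    · refine Finset.sup_le fun n hn => hcard n ?_
      rw [Finset.mem_filter] at hn
      exact hn.2
    · apply Finset.le_sup (f := Finset.card)
      rw [Finset.mem_filter]
      exact ⟨Finset.mem_powerset.2 hmh.1, hmh⟩
end

section
/- Let G be a simple graph and let M and M' be subgraphs of G, each of which is a matching (every vertex of M is incident to exactly one edge of M, and likewise for M'). Let W be a walk in G whose edges alternate between M' and M (the first edge lies in M', consecutive edges lie in different matchings, and every edge lies in M or M'), and suppose the starting vertex of W is not covered by any edge of M. Then W has no repeated vertices, i.e., W is a path. -/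
/-- **Alternating walks from an unmatched vertex are paths.** Let `M` and `M'` be
matching subgraphs of a simple graph `G`. Let `W` be a walk in `G` whose edges alternate
between `M'` and `M` (edges at even positions lie in `M'`, edges at odd positions lie in
`M`; in particular the first edge lies in `M'` and every edge lies in `M` or `M'`), and
suppose the starting vertex of `W` is not covered by any edge of `M`. Then `W` has no
repeated vertices, i.e., `W` is a path. -/
theorem alternating_walk_isPath {V : Type*} (G : SimpleGraph V)
    (M M' : G.Subgraph) (hM : M.IsMatching) (hM' : M'.IsMatching)
    {u v : V} (W : G.Walk u v)
    (halt : ∀ (i : ℕ) (hi : i < W.edges.length),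
      W.edges.get ⟨i, hi⟩ ∈ (if i % 2 = 0 then M'.edgeSet else M.edgeSet))
    (hu : ∀ x, ¬ M.Adj u x) :
    W.IsPath := by
  have uM : ∀ a b c, M.Adj a b → M.Adj a c → b = c := fun a b c h1 h2 =>
    (hM (M.edge_vert h1)).unique h1 h2
  have uM' : ∀ a b c, M'.Adj a b → M'.Adj a c → b = c := fun a b c h1 h2 =>
    (hM' (M'.edge_vert h1)).unique h1 h2
  have ha : ∀ i, i < W.length →
      (i % 2 = 0 → M'.Adj (W.getVert i) (W.getVert (i+1))) ∧
      (i % 2 = 1 → M.Adj (W.getVert i) (W.getVert (i+1))) := by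
    intro i hi
    have h := halt i (by simpa using hi)
    have he : W.edges.get ⟨i, by simpa using hi⟩ = s(W.getVert i, W.getVert (i+1)) := by
      simp [SimpleGraph.Walk.edges, SimpleGraph.Walk.darts_getElem_eq_getVert]
    rw [he] at h
    constructor <;> intro h0 <;> simpa [h0] using h
  have key : ∀ n, n ≤ W.length → ∀ j, j < n → W.getVert j ≠ W.getVert n := by
    intro n
    induction n using Nat.strong_induction_on with
    | _ n ih =>
    intro hn j hj heq
    obtain ⟨k, rfl⟩ : ∃ k, n = k + 1 := ⟨n - 1, by omega⟩
    have hk := ha k (by omega)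
    have hjj := ha j (by omega)
    by_cases hp : k % 2 = j % 2
    · have e : W.getVert (j+1) = W.getVert k := by
        rcases Nat.mod_two_eq_zero_or_one k with h | h
        · exact uM' _ _ _ (hjj.2 |> fun _ => hjj.1 (by omega)) (heq ▸ (hk.1 h).symm)
        · exact uM _ _ _ (hjj.2 (by omega)) (heq ▸ (hk.2 h).symm)
      rcases Nat.lt_trichotomy (j+1) k with h | h | h
      · exact ih k (by omega) (by omega) _ h e
      · omega
      · have : j = k := by omega
        subst this
        exact (W.adj_getVert_succ (by omega)).ne heq
    · rcases j with _ | j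
      · refine hu (W.getVert k) ?_
        have := (hk.2 (by omega)).symm
        rw [← heq] at this
        simpa using this
      · have hj' := ha j (by omega)
        have e : W.getVert j = W.getVert k := by
          rcases Nat.mod_two_eq_zero_or_one k with h | h
          · exact uM' _ _ _ (hj'.1 (by omega)).symm (heq ▸ (hk.1 h).symm)
          · exact uM _ _ _ (hj'.2 (by omega)).symm (heq ▸ (hk.2 h).symm)
        exact ih k (by omega) (by omega) _ (by omega) e
  rw [SimpleGraph.Walk.isPath_def, List.nodup_iff_injective_get]
  rintro ⟨a, ha1⟩ ⟨b, hb1⟩ hab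
  simp only [List.get_eq_getElem, SimpleGraph.Walk.support_getElem_eq_getVert] at hab
  simp only [SimpleGraph.Walk.length_support] at ha1 hb1
  rcases Nat.lt_trichotomy a b with h | h | h
  · exact absurd hab (key b (by omega) a h)
  · exact Fin.ext h
  · exact absurd hab.symm (key a (by omega) b h)
end
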